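/- arXiv:2101.07159 — 6 statements merged into one kernel-verified Lean document; each statement's English description precedes it below -/
import Mathlib

section
/- For the specific real 3×3 matrices A = [[1,0,1],[0,−1,δ],[1,0,1]] and B = [[−1,0,1],[0,1,0],[1,ε,−1]], the determinant of the 9×9 matrix whose columns are the vectorizations of I, A, A², B, B², AB, BA, [A,[A,B]], [B,[B,A]] equals −27·δ⁵ε⁵ + 9·δ⁶ε⁶. -/
open Matrix Polynomial

/-- Determinant of the 9×9 matrix whose columns are the vectorizations of nine 3×3 matrices. -/
noncomputable def vecDet {K : Type*} [CommRing K]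
    (v : Fin 9 → Matrix (Fin 3) (Fin 3) K) : K :=
  Matrix.det (Matrix.of fun p q : Fin 3 × Fin 3 =>
    v (finProdFinEquiv q) p.1 p.2)

/-- H(M) = (tr(M)² − tr(M²))/2. -/
noncomputable def Hm {K : Type*} [Field K] (M : Matrix (Fin 3) (Fin 3) K) : K :=
  (Matrix.trace M ^ 2 - Matrix.trace (M * M)) / 2

/-- The nine matrices I, A, A², B, B², AB, BA, [A,[A,B]], [B,[B,A]]. -/
def nine {K : Type*} [CommRing K] (A B : Matrix (Fin 3) (Fin 3) K) :
    Fin 9 → Matrix (Fin 3) (Fin 3) K :=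
  ![1, A, A ^ 2, B, B ^ 2, A * B, B * A,
    A * (A * B - B * A) - (A * B - B * A) * A,
    B * (B * A - A * B) - (B * A - A * B) * B]
def Amat (δ : ℝ) : Matrix (Fin 3) (Fin 3) ℝ := !![1, 0, 1; 0, -1, δ; 1, 0, 1]

def Bmat (ε : ℝ) : Matrix (Fin 3) (Fin 3) ℝ := !![-1, 0, 1; 0, 1, 0; 1, ε, -1]

/-- Rows are the vectorizations of the nine matrices for `Amat δ` and `Bmat ε`. -/
def nineRows (δ ε : ℝ) : Matrix (Fin 9) (Fin 9) ℝ :=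
  !![1, 0, 0, 0, 1, 0, 0, 0, 1;
     1, 0, 1, 0, -1, δ, 1, 0, 1;
     2, 0, 2, δ, 1, 0, 2, 0, 2;
     -1, 0, 1, 0, 1, 0, 1, ε, -1;
     2, ε, -2, 0, 1, 0, -2, 0, 2;
     0, ε, 0, δ, -1 + δ * ε, -δ, 0, ε, 0;
     0, 0, 0, 0, -1, δ, 0, -ε, δ * ε;
     0, 4 * ε, -2 * δ * ε, 0, 2 * δ * ε, 3 * δ - 2 * δ ^ 2 * ε, δ * ε, 5 * ε, -2 * δ * ε;
     0, 0, δ * ε, -4 * δ, -2 * δ * ε, 5 * δ, -2 * δ * ε, 3 * ε - 2 * δ * ε ^ 2, 2 * δ * ε]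

/-- Unit lower triangular factor of `nineRows`. -/
noncomputable def nineRowsLower (δ ε : ℝ) : Matrix (Fin 9) (Fin 9) ℝ :=
  !![1, 0, 0, 0, 0, 0, 0, 0, 0;
     1, 1, 0, 0, 0, 0, 0, 0, 0;
     2, 2, 1, 0, 0, 0, 0, 0, 0;
     -1, 1, (4 / 3), 1, 0, 0, 0, 0, 0;
     2, -2, (-5 / 3), 0, 1, 0, 0, 0, 0;
     0, 0, (-1 / 3) + (1 / 3) * δ * ε, 1, 1, 1, 0, 0, 0;
     0, 0, (-1 / 3), -1, 0, 0, 1, 0, 0;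
     0, -2 * δ * ε, (-2 / 3) * δ * ε, 5, 4, 0, 0, 1, 0;
     0, δ * ε, 0, 3 - 2 * δ * ε, 0, 0, 0, 0, 1]

/-- Sparse row-reduced factor of `nineRows`. -/
noncomputable def nineRowsReduced (δ ε : ℝ) : Matrix (Fin 9) (Fin 9) ℝ :=
  !![1, 0, 0, 0, 1, 0, 0, 0, 1;
     0, 0, 1, 0, -2, δ, 1, 0, 0;
     0, 0, 0, δ, 3, -2 * δ, 0, 0, 0;
     0, 0, 0, (-4 / 3) * δ, 0, (5 / 3) * δ, 0, ε, 0;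
     0, ε, 0, (5 / 3) * δ, 0, (-4 / 3) * δ, 0, 0, 0;
     0, 0, 0, δ - (1 / 3) * δ ^ 2 * ε, 0, -2 * δ + (2 / 3) * δ ^ 2 * ε, 0, 0, 0;
     0, 0, 0, -δ, 0, 2 * δ, 0, 0, δ * ε;
     0, 0, 0, (2 / 3) * δ ^ 2 * ε, 0, (-4 / 3) * δ ^ 2 * ε, 3 * δ * ε, 0, -2 * δ * ε;
     0, 0, 0, (-8 / 3) * δ ^ 2 * ε, 0, (7 / 3) * δ ^ 2 * ε, -3 * δ * ε, 0, 2 * δ * ε]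

theorem nineRows_eq_mul (δ ε : ℝ) :
    nineRows δ ε = nineRowsLower δ ε * nineRowsReduced δ ε := by
  ext i j
  fin_cases i <;> fin_cases j <;>
    simp [nineRows, nineRowsLower, nineRowsReduced, Matrix.mul_apply, Fin.sum_univ_succ] <;> ring

theorem det_nineRowsLower (δ ε : ℝ) : (nineRowsLower δ ε).det = 1 := by
  rw [Matrix.det_of_isLowerTriangular]
  · simp [nineRowsLower, Fin.prod_univ_succ]
  · intro i j hij
    fin_cases i <;> fin_cases j <;> first | rfl | exact absurd hij (by decide)

set_option maxHeartbeats 4000000 in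
theorem det_nineRowsReduced (δ ε : ℝ) :
    (nineRowsReduced δ ε).det = -27 * δ ^ 5 * ε ^ 5 + 9 * δ ^ 6 * ε ^ 6 := by
  unfold nineRowsReduced
  iterate 3
    rw [Matrix.det_succ_column_zero]
    simp [Fin.sum_univ_succ, Fin.succAbove]
  simp [Matrix.det_succ_column_zero, Fin.sum_univ_succ, Fin.succAbove]
  ring

set_option maxHeartbeats 2000000 in
theorem vecDet_nine_eq_det_nineRows (δ ε : ℝ) :
    vecDet (nine (Amat δ) (Bmat ε)) = (nineRows δ ε).det := by
  have h : (Matrix.of fun p q : Fin 3 × Fin 3 =>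
      nine (Amat δ) (Bmat ε) (finProdFinEquiv q) p.1 p.2) =
        ((nineRows δ ε).submatrix finProdFinEquiv finProdFinEquiv)ᵀ := by
    ext ⟨a, b⟩ ⟨c, d⟩
    fin_cases a <;> fin_cases b <;> fin_cases c <;> fin_cases d <;>
      simp [finProdFinEquiv, nine, nineRows, Amat, Bmat, pow_two,
        -mul_eq_mul_left_iff, -mul_eq_mul_right_iff] <;> ring
  unfold vecDet
  rw [h, Matrix.det_transpose, Matrix.det_submatrix_equiv_self]

theorem stmt_1 (δ ε : ℝ) :
    vecDet (nine (Amat δ) (Bmat ε)) = -27 * δ ^ 5 * ε ^ 5 + 9 * δ ^ 6 * ε ^ 6 := by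
  rw [vecDet_nine_eq_det_nineRows, nineRows_eq_mul, Matrix.det_mul, det_nineRowsLower, one_mul,
    det_nineRowsReduced]
end

section
/- There exist 3×3 real matrices A and B with det([A,B]) ≠ 0 and H([A,B]) ≠ 0 such that det(I, A, A², B, B², AB, BA, [A,[A,B]], [B,[B,A]]) ≠ 9·det([A,B])·H([A,B]). (E.g., take A = [[1,0,1],[0,−1,1],[1,0,1]] and B = [[−1,0,1],[0,1,0],[1,1,−1]], i.e., δ = ε = 1.) -/
open Matrix Polynomial

/-- Rescaling each of the nine matrices rescales `vecDet` by the product of the factors. -/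
theorem vecDet_smul {K : Type*} [CommRing K] (c : Fin 9 → K)
    (v : Fin 9 → Matrix (Fin 3) (Fin 3) K) :
    vecDet (fun i => c i • v i) = (∏ i, c i) * vecDet v := by
  rw [vecDet, vecDet, ← Equiv.prod_comp (finProdFinEquiv : Fin 3 × Fin 3 ≃ Fin 9) c,
    ← Matrix.det_mul_row]
  rfl

/-- The determinant of the nine matrices is an even function of `A`. -/
theorem vecDet_nine_neg_left {K : Type*} [CommRing K] (A B : Matrix (Fin 3) (Fin 3) K) :
    vecDet (nine (-A) B) = vecDet (nine A B) := by
  have h : nine (-A) B =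
      fun i => (![1, -1, 1, 1, 1, -1, -1, 1, -1] : Fin 9 → K) i • nine A B i := by
    funext i
    fin_cases i <;> simp [nine] <;> noncomm_ring
  rw [h, vecDet_smul]
  simp [Fin.prod_univ_succ]

theorem Hm_neg {K : Type*} [Field K] (M : Matrix (Fin 3) (Fin 3) K) : Hm (-M) = Hm M := by
  simp [Hm]

theorem stmt_2 :
    ∃ A B : Matrix (Fin 3) (Fin 3) ℝ,
      (A * B - B * A).det ≠ 0 ∧ Hm (A * B - B * A) ≠ 0 ∧
      vecDet (nine A B) ≠ 9 * (A * B - B * A).det * Hm (A * B - B * A) := by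
  have key : ∃ A B : Matrix (Fin 3) (Fin 3) ℝ,
      (A * B - B * A).det ≠ 0 ∧ Hm (A * B - B * A) ≠ 0 := by
    refine ⟨!![1, 0, 1; 0, -1, 1; 1, 0, 1], !![-1, 0, 1; 0, 1, 0; 1, 1, -1], ?_⟩
    have hcomm : (!![1, 0, 1; 0, -1, 1; 1, 0, 1] * !![-1, 0, 1; 0, 1, 0; 1, 1, -1] -
        !![-1, 0, 1; 0, 1, 0; 1, 1, -1] * !![1, 0, 1; 0, -1, 1; 1, 0, 1] :
          Matrix (Fin 3) (Fin 3) ℝ) = !![0, 1, 0; 1, 1, -2; 0, 2, -1] := by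
      ext i j
      fin_cases i <;> fin_cases j <;> norm_num [Matrix.mul_apply, Fin.sum_univ_three]
    rw [hcomm]
    constructor
    · simp [Matrix.det_fin_three]
    · simp [Hm, Matrix.trace_fin_three]
      norm_num
  obtain ⟨A, B, hdet, hH⟩ := key
  by_cases h : vecDet (nine A B) = 9 * (A * B - B * A).det * Hm (A * B - B * A)
  · have hC : -A * B - B * -A = -(A * B - B * A) := by noncomm_ring
    have hdet_neg : (-(A * B - B * A)).det = -(A * B - B * A).det := by
      rw [Matrix.det_neg, Fintype.card_fin]
      ring
    refine ⟨-A, B, ?_, ?_, ?_⟩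
    · rwa [hC, hdet_neg, neg_ne_zero]
    · rwa [hC, Hm_neg]
    · rw [hC, Hm_neg, hdet_neg, vecDet_nine_neg_left, h]
      intro h'
      exact mul_ne_zero hdet hH (by linarith)
  · exact ⟨A, B, hdet, hH, h⟩
end

section
/- Let A, B be 3×3 matrices over a commutative ring (or field of characteristic zero). Then det(I, A, A², B, B², AB, BA, [A,[A,B]], [B,[B,A]]) = −9·(det[A,B])²·H([A,B]), where the left side is the determinant of the 9×9 matrix whose columns are the vectorizations of the nine listed matrices. -/
open Matrix Polynomial

open scoped Kronecker

theorem vecDet_mul {K : Type*} [CommRing K] (v : Fin 9 → Matrix (Fin 3) (Fin 3) K)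
    (U : Matrix (Fin 9) (Fin 9) K) :
    vecDet (fun q => ∑ p, U p q • v p) = vecDet v * U.det := by
  unfold vecDet
  rw [← Matrix.det_submatrix_equiv_self (finProdFinEquiv (m := 3) (n := 3)) U, ← Matrix.det_mul]
  congr 1
  ext p q
  simp only [Matrix.of_apply, Matrix.mul_apply, Matrix.submatrix_apply, Matrix.sum_apply,
    Matrix.smul_apply, smul_eq_mul]
  rw [← Equiv.sum_comp (finProdFinEquiv (m := 3) (n := 3))]
  exact Finset.sum_congr rfl fun _ _ => mul_comm _ _

theorem vecDet_mul_mul {K : Type*} [CommRing K] (v : Fin 9 → Matrix (Fin 3) (Fin 3) K)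
    (P Q : Matrix (Fin 3) (Fin 3) K) :
    vecDet (fun q => P * v q * Q) = (P.det * Q.det) ^ 3 * vecDet v := by
  have h : (P ⊗ₖ Qᵀ).det = (P.det * Q.det) ^ 3 := by
    simp [Matrix.det_kronecker, mul_pow]
  unfold vecDet
  rw [← h, ← Matrix.det_mul]
  congr 1
  ext p q
  simp only [Matrix.of_apply, Matrix.mul_apply, Matrix.kroneckerMap_apply, Matrix.transpose_apply,
    Fintype.sum_prod_type, Finset.sum_mul]
  rw [Finset.sum_comm]
  exact Finset.sum_congr rfl fun _ _ => Finset.sum_congr rfl fun _ _ => by ring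

theorem vecDet_nine_conj {K : Type*} [CommRing K] (A B P Q : Matrix (Fin 3) (Fin 3) K)
    (h : Q * P = 1) : vecDet (nine (P * A * Q) (P * B * Q)) = vecDet (nine A B) := by
  have h' : P * Q = 1 := mul_eq_one_comm.mp h
  have hmul (X Y : Matrix (Fin 3) (Fin 3) K) : P * X * Q * (P * Y * Q) = P * (X * Y) * Q := by
    calc P * X * Q * (P * Y * Q) = P * X * (Q * P) * Y * Q := by noncomm_ring
      _ = P * (X * Y) * Q := by rw [h]; noncomm_ring
  have hsub (X Y : Matrix (Fin 3) (Fin 3) K) : P * X * Q - P * Y * Q = P * (X - Y) * Q := by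
    noncomm_ring
  have key : nine (P * A * Q) (P * B * Q) = fun q => P * nine A B q * Q := by
    ext1 q
    fin_cases q <;> simp [nine, pow_two, hmul, hsub, h']
  rw [key, vecDet_mul_mul, ← Matrix.det_mul, h', Matrix.det_one, one_pow, one_mul]

theorem map_vecDet_nine {K L : Type*} [CommRing K] [CommRing L] (f : K →+* L)
    (A B : Matrix (Fin 3) (Fin 3) K) :
    f (vecDet (nine A B)) = vecDet (nine (f.mapMatrix A) (f.mapMatrix B)) := by
  have key (q : Fin 9) : nine (f.mapMatrix A) (f.mapMatrix B) q = f.mapMatrix (nine A B q) := by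
    fin_cases q <;> simp [nine, -RingHom.mapMatrix_apply]
  unfold vecDet
  rw [RingHom.map_det]
  congr 1
  ext p q
  exact (congrFun (congrFun (key _) p.1) p.2).symm

/-- The words `1, A, A², B, B², AB, BA, ABA, BAB`. -/
def nineWords {K : Type*} [CommRing K] (A B : Matrix (Fin 3) (Fin 3) K) :
    Fin 9 → Matrix (Fin 3) (Fin 3) K :=
  ![1, A, A * A, B, B * B, A * B, B * A, A * B * A, B * A * B]

/-- The Cayley–Hamilton theorem for `3 × 3` matrices, polarized once. -/
theorem polarized_cayleyHamilton {K : Type*} [CommRing K] (A B : Matrix (Fin 3) (Fin 3) K) :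
    ∃ c₀ c₁ c₂ c₃ c₄ : K, A * A * B =
      -(A * B * A) - B * A * A + c₀ • 1 + c₁ • A + c₂ • (A * A) + c₃ • B +
        c₄ • (A * B + B * A) := by
  refine ⟨(A.adjugate * B).trace, (A * B).trace - A.trace * B.trace, B.trace,
    -A.adjugate.trace, A.trace, ?_⟩
  ext i j
  fin_cases i <;> fin_cases j <;>
    simp [Matrix.mul_apply, Matrix.trace, Fin.sum_univ_succ, Matrix.adjugate_fin_three,
        Matrix.vecMul, dotProduct] <;> ring

theorem vecDet_nine {K : Type*} [CommRing K] (A B : Matrix (Fin 3) (Fin 3) K) :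
    vecDet (nine A B) = 9 * vecDet (nineWords A B) := by
  obtain ⟨c₀, c₁, c₂, c₃, c₄, hc⟩ := polarized_cayleyHamilton A B
  obtain ⟨d₀, d₁, d₂, d₃, d₄, hd⟩ := polarized_cayleyHamilton B A
  have key : nine A B = fun j => ∑ i, (!![1, 0, 0, 0, 0, 0, 0, c₀, d₀;
      0, 1, 0, 0, 0, 0, 0, c₁, d₃;
      0, 0, 1, 0, 0, 0, 0, c₂, 0;
      0, 0, 0, 1, 0, 0, 0, c₃, d₁;
      0, 0, 0, 0, 1, 0, 0, 0, d₂;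
      0, 0, 0, 0, 0, 1, 0, c₄, d₄;
      0, 0, 0, 0, 0, 0, 1, c₄, d₄;
      0, 0, 0, 0, 0, 0, 0, -3, 0;
      0, 0, 0, 0, 0, 0, 0, 0, -3] : Matrix (Fin 9) (Fin 9) K) i j • nineWords A B i := by
    ext1 j
    fin_cases j <;>
      simp [nine, nineWords, Fin.sum_univ_succ, pow_two, mul_sub, sub_mul, ← mul_assoc, hc, hd]
    all_goals module
  rw [key, vecDet_mul, Matrix.det_of_isUpperTriangular]
  · simp [Fin.prod_univ_succ]
    ring
  · intro i j hij
    fin_cases i <;> fin_cases j <;> first | exact absurd hij (by decide) | rfl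

set_option maxHeartbeats 1000000 in
theorem vecDet_nineWords_add {K : Type*} [CommRing K] (A B : Matrix (Fin 3) (Fin 3) K)
    {p q r : K} (hA : A * A * A = p • 1 + q • A + r • (A * A)) (x y z : K) :
    vecDet (nineWords A (B + (x • 1 + y • A + z • (A * A)))) = vecDet (nineWords A B) := by
  obtain ⟨c₀, c₁, c₂, c₃, c₄, hc⟩ := polarized_cayleyHamilton A B
  let u₀ := x ^ 2 + 2 * p * y * z + p * r * z ^ 2 + z * c₀
  let u₁ := 2 * x * y + 2 * q * y * z + (p + q * r) * z ^ 2 + z * c₁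
  let u₂ := y ^ 2 + 2 * x * z + 2 * r * y * z + (q + r ^ 2) * z ^ 2 + z * c₂
  let v₀ := p * z * x + p * ((x + q * z) * z + (y + r * z) * y) + p * r * (y + r * z) * z +
    (y + r * z) * c₀
  let v₁ := p * z * y + (x + q * z) * x + q * ((x + q * z) * z + (y + r * z) * y) +
    (p + q * r) * (y + r * z) * z + (y + r * z) * c₁
  let v₂ := p * z * z + (x + q * z) * y + (y + r * z) * x +
    r * ((x + q * z) * z + (y + r * z) * y) + (q + r ^ 2) * (y + r * z) * z + (y + r * z) * c₂
  have hBA : B * A * A * A = p • B + q • (B * A) + r • (B * A * A) := by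
    rw [mul_assoc, mul_assoc, ← mul_assoc A, hA]
    simp [mul_add, mul_assoc]
  have key : nineWords A (B + (x • 1 + y • A + z • (A * A))) =
      fun j => ∑ i, (!![1, 0, 0, x, u₀, p * z, p * z, p * (y + r * z), v₀;
      0, 1, 0, y, u₁, x + q * z, x + q * z, p * z + q * (y + r * z), v₁;
      0, 0, 1, z, u₂, y + r * z, y + r * z, x + q * z + r * (y + r * z), v₂;
      0, 0, 0, 1, 2 * x + z * c₃, 0, 0, 0, 2 * p * z + (y + r * z) * c₃;
      0, 0, 0, 0, 1, 0, 0, 0, 0;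
      0, 0, 0, 0, y + z * c₄, 1, 0, 0, x + q * z + (y + r * z) * c₄;
      0, 0, 0, 0, y + z * c₄, 0, 1, 0, x + q * z + (y + r * z) * c₄;
      0, 0, 0, 0, -z, 0, 0, 1, -(y + r * z);
      0, 0, 0, 0, 0, 0, 0, 0, 1] : Matrix (Fin 9) (Fin 9) K) i j • nineWords A B i := by
    ext1 j
    fin_cases j <;>
      simp [u₀, u₁, u₂, v₀, v₁, v₂, nineWords, Fin.sum_univ_succ, mul_add, add_mul,
        ← mul_assoc, hc, hA, hBA]
    all_goals module
  let e : Equiv.Perm (Fin 9) := c[4, 5, 6, 7]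
  rw [key, vecDet_mul, ← Matrix.det_submatrix_equiv_self e, Matrix.det_of_isUpperTriangular]
  · have : ∀ i, e i = ![0, 1, 2, 3, 5, 6, 7, 4, 8] i := by decide
    simp [Fin.prod_univ_succ, this]
  · intro i j hij
    fin_cases i <;> fin_cases j <;> first | exact absurd hij (by decide) | rfl

theorem vecDet_eq_det_fin_six {K : Type*} [CommRing K] (v : Fin 9 → Matrix (Fin 3) (Fin 3) K)
    (h : ∀ (i : Fin 3) (j : Fin 9), v j i 0 = if (i : ℕ) = j then 1 else 0) :
    vecDet v = Matrix.det (Matrix.of fun i j : Fin 6 =>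
      v (Fin.natAdd 3 j) (![0, 0, 1, 1, 2, 2] i) (![1, 2, 1, 2, 1, 2] i)) := by
  let M : Matrix (Fin 9) (Fin 9) K := Matrix.of fun i j =>
    v j ((finProdFinEquiv (m := 3) (n := 3)).symm i).1
      ((finProdFinEquiv (m := 3) (n := 3)).symm i).2
  have hv : vecDet v = M.det := by
    unfold vecDet
    rw [← Matrix.det_submatrix_equiv_self (finProdFinEquiv (m := 3) (n := 3)).symm]
    congr 1
    ext i j
    simp only [Matrix.submatrix_apply, Matrix.of_apply, Equiv.apply_symm_apply, M]
  have h₀ (j : Fin 3) : (finProdFinEquiv (m := 3) (n := 3)).symm (![0, 3, 6] j) = (j, 0) := by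
    revert j; decide
  have hM (i : Fin 3) (j : Fin 9) : M (![0, 3, 6] i) j = if (i : ℕ) = j then 1 else 0 := by
    simp only [M, Matrix.of_apply, h₀, h]
  have h1 (j : Fin 9) : M 0 j = if 0 = (j : ℕ) then 1 else 0 := hM 0 j
  have h2 (j : Fin 9) : M 3 j = if 1 = (j : ℕ) then 1 else 0 := hM 1 j
  have h3 (j : Fin 9) : M 6 j = if 2 = (j : ℕ) then 1 else 0 := hM 2 j
  rw [hv, Matrix.det_succ_row _ 0, Fin.sum_univ_succ, Finset.sum_eq_zero, add_zero,
    Matrix.det_succ_row _ 2, Fin.sum_univ_succ, Finset.sum_eq_zero, add_zero,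
    Matrix.det_succ_row _ 4, Fin.sum_univ_succ, Finset.sum_eq_zero, add_zero]
  · have e2 : (M.submatrix (Fin.succAbove 0) (Fin.succAbove 0)) 2 0 = 1 := h2 1
    have e3 : ((M.submatrix (Fin.succAbove 0) (Fin.succAbove 0)).submatrix
      (Fin.succAbove 2) (Fin.succAbove 0)) 4 0 = 1 := h3 2
    rw [h1, e2, e3]
    norm_num
    congr 1
    ext i j
    fin_cases i <;> fin_cases j <;> rfl
  · intro j _
    refine mul_eq_zero_of_left (mul_eq_zero_of_right _ ((h3 j.succ.succ.succ).trans ?_)) _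
    exact if_neg (by simp)
  · intro j _
    refine mul_eq_zero_of_left (mul_eq_zero_of_right _ ((h2 j.succ.succ).trans ?_)) _
    exact if_neg (by simp)
  · intro j _
    refine mul_eq_zero_of_left (mul_eq_zero_of_right _ ((h1 j.succ).trans ?_)) _
    exact if_neg (by simp)

theorem vecDet_eq_vecDet_sub {K : Type*} [CommRing K] (v : Fin 9 → Matrix (Fin 3) (Fin 3) K)
    (c : Fin 3 → Fin 9 → K) :
    vecDet v = vecDet (fun j => if (j : ℕ) < 3 then v j else
      v j - (c 0 j • v 0 + c 1 j • v 1 + c 2 j • v 2)) := by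
  have key : (fun j : Fin 9 => if (j : ℕ) < 3 then v j else
      v j - (c 0 j • v 0 + c 1 j • v 1 + c 2 j • v 2)) = fun j => ∑ i, (!![
      1, 0, 0, -c 0 3, -c 0 4, -c 0 5, -c 0 6, -c 0 7, -c 0 8;
      0, 1, 0, -c 1 3, -c 1 4, -c 1 5, -c 1 6, -c 1 7, -c 1 8;
      0, 0, 1, -c 2 3, -c 2 4, -c 2 5, -c 2 6, -c 2 7, -c 2 8;
      0, 0, 0, 1, 0, 0, 0, 0, 0;
      0, 0, 0, 0, 1, 0, 0, 0, 0;
      0, 0, 0, 0, 0, 1, 0, 0, 0;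
      0, 0, 0, 0, 0, 0, 1, 0, 0;
      0, 0, 0, 0, 0, 0, 0, 1, 0;
      0, 0, 0, 0, 0, 0, 0, 0, 1] : Matrix (Fin 9) (Fin 9) K) i j • v i := by
    ext1 j
    fin_cases j <;> simp [Fin.sum_univ_succ]
    all_goals module
  rw [key, vecDet_mul, Matrix.det_of_isUpperTriangular]
  · simp [Fin.prod_univ_succ]
  · intro i j hij
    fin_cases i <;> fin_cases j <;> first | exact absurd hij (by decide) | rfl

set_option maxHeartbeats 0 in
theorem two_mul_vecDet_nineWords_companion_aux {K : Type*} [CommRing K] (a b c d f g p q : K) :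
    let A : Matrix (Fin 3) (Fin 3) K := !![0, 0, p; 1, 0, q; 0, 1, 0]
    let B : Matrix (Fin 3) (Fin 3) K := !![0, a, b; 0, c, d; 0, f, g]
    2 * vecDet (nineWords A B) =
      (A * B - B * A).det ^ 2 * ((A * B - B * A) * (A * B - B * A)).trace := by
  intro A B
  rw [vecDet_eq_vecDet_sub _ fun i j => nineWords A B j i 0, vecDet_eq_det_fin_six]
  · have key : (Matrix.of fun i j : Fin 6 => (fun j : Fin 9 => if (j : ℕ) < 3 then nineWords A B j
      else nineWords A B j - (nineWords A B j 0 0 • nineWords A B 0 +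
        nineWords A B j 1 0 • nineWords A B 1 + nineWords A B j 2 0 • nineWords A B 2))
      (Fin.natAdd 3 j) (![0, 0, 1, 1, 2, 2] i) (![1, 2, 1, 2, 1, 2] i)) =
      !![a, a*c + b*f, f*p, b - f*p, g*p - c*p, a^2 + a*f*q + b*c;
      b, a*d + b*g, g*p, a*q - c*p, -a*p, a*b + a*g*q + b*d;
      c, c^2 + d*f, a + f*q, d - a - f*q, b + g*q - f*p - c*q, a*c + c*f*q + c*d;
      d, c*d + d*g, b + g*q, -f*p, -c*p, b*c + c*g*q + d^2;
      f, c*f + f*g, c, g - c, d - a - f*q, a*f + f^2*q + c*g;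
      g, d*f + g^2, d, -a, -f*p, b*f + f*g*q + d*g] := by
      ext i j
      fin_cases j <;> fin_cases i <;>
        simp [nineWords, A, B, Matrix.one_apply] <;> ring
    rw [key]
    simp [A, B, Matrix.det_succ_row_zero, Fin.sum_univ_succ, Fin.succAbove, Matrix.trace]
    ring
  · intro i j
    fin_cases i <;> fin_cases j <;>
      simp [nineWords, A, B]

theorem two_mul_vecDet_nineWords_companion {K : Type*} [CommRing K] (p q : K)
    (B : Matrix (Fin 3) (Fin 3) K) :
    let A : Matrix (Fin 3) (Fin 3) K := !![0, 0, p; 1, 0, q; 0, 1, 0]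
    2 * vecDet (nineWords A B) =
      (A * B - B * A).det ^ 2 * ((A * B - B * A) * (A * B - B * A)).trace := by
  intro A
  have hA : A * A * A = p • 1 + q • A + (0 : K) • (A * A) := by
    ext i j
    fin_cases i <;> fin_cases j <;> simp [A, mul_comm]
  obtain ⟨a, b, c, d, f, g, hB⟩ : ∃ a b c d f g : K,
      B = !![0, a, b; 0, c, d; 0, f, g] + (B 0 0 • 1 + B 1 0 • A + B 2 0 • (A * A)) := by
    let B' := B - (B 0 0 • 1 + B 1 0 • A + B 2 0 • (A * A))
    refine ⟨B' 0 1, B' 0 2, B' 1 1, B' 1 2, B' 2 1, B' 2 2, ?_⟩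
    ext i j
    fin_cases i <;> fin_cases j <;> simp [A, B']
  have hC (X : Matrix (Fin 3) (Fin 3) K) (x y z : K) :
      A * (X + (x • 1 + y • A + z • (A * A))) - (X + (x • 1 + y • A + z • (A * A))) * A =
        A * X - X * A := by
    simp only [mul_add, add_mul, mul_smul_comm, smul_mul_assoc, mul_one, one_mul, mul_assoc]
    abel
  rw [hB, hC, vecDet_nineWords_add A _ hA]
  exact two_mul_vecDet_nineWords_companion_aux a b c d f g p q

/-- The difference of the two sides of the identity for `vecDet (nine A B)`, multiplied by `2`. -/
noncomputable def nineDefect {K : Type*} [CommRing K] (A B : Matrix (Fin 3) (Fin 3) K) : K :=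
  2 * vecDet (nine A B) -
    9 * ((A * B - B * A).det ^ 2 * ((A * B - B * A) * (A * B - B * A)).trace)

theorem map_nineDefect {K L : Type*} [CommRing K] [CommRing L] (f : K →+* L)
    (A B : Matrix (Fin 3) (Fin 3) K) :
    f (nineDefect A B) = nineDefect (f.mapMatrix A) (f.mapMatrix B) := by
  have htr (M : Matrix (Fin 3) (Fin 3) K) : f M.trace = (f.mapMatrix M).trace := by
    simp [Matrix.trace]
  simp only [nineDefect, map_sub, map_mul, map_pow, map_ofNat, map_vecDet_nine, RingHom.map_det,
    htr]

theorem nineDefect_conj {K : Type*} [CommRing K] (A B P Q : Matrix (Fin 3) (Fin 3) K)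
    (h : Q * P = 1) : nineDefect (P * A * Q) (P * B * Q) = nineDefect A B := by
  have hmul (X Y : Matrix (Fin 3) (Fin 3) K) : P * X * Q * (P * Y * Q) = P * (X * Y) * Q := by
    calc P * X * Q * (P * Y * Q) = P * X * (Q * P) * Y * Q := by noncomm_ring
      _ = P * (X * Y) * Q := by rw [h]; noncomm_ring
  have hsub (X Y : Matrix (Fin 3) (Fin 3) K) : P * X * Q - P * Y * Q = P * (X - Y) * Q := by
    noncomm_ring
  have hdet (X : Matrix (Fin 3) (Fin 3) K) : (P * X * Q).det = X.det := by
    rw [Matrix.det_mul_comm, ← mul_assoc, h, one_mul]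
  have htr (X : Matrix (Fin 3) (Fin 3) K) : (P * X * Q).trace = X.trace := by
    rw [Matrix.trace_mul_comm, ← mul_assoc, h, one_mul]
  simp only [nineDefect, vecDet_nine_conj A B P Q h, hmul, hsub, hdet, htr]

theorem nineDefect_sub_smul_one {K : Type*} [CommRing K] (A B : Matrix (Fin 3) (Fin 3) K) (s : K) :
    nineDefect (A - s • 1) B = nineDefect A B := by
  have hC : (A - s • 1) * B - B * (A - s • 1) = A * B - B * A := by
    simp [sub_mul, mul_sub]
  have key : nine (A - s • 1) B = fun j => ∑ i, (!![1, -s, s ^ 2, 0, 0, 0, 0, 0, 0;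
      0, 1, -2 * s, 0, 0, 0, 0, 0, 0;
      0, 0, 1, 0, 0, 0, 0, 0, 0;
      0, 0, 0, 1, 0, -s, -s, 0, 0;
      0, 0, 0, 0, 1, 0, 0, 0, 0;
      0, 0, 0, 0, 0, 1, 0, 0, 0;
      0, 0, 0, 0, 0, 0, 1, 0, 0;
      0, 0, 0, 0, 0, 0, 0, 1, 0;
      0, 0, 0, 0, 0, 0, 0, 0, 1] : Matrix (Fin 9) (Fin 9) K) i j • nine A B i := by
    ext1 j
    fin_cases j <;>
      simp [nine, Fin.sum_univ_succ, pow_two, mul_sub, sub_mul]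
    all_goals module
  rw [nineDefect, nineDefect, hC, key, vecDet_mul, Matrix.det_of_isUpperTriangular]
  · simp [Fin.prod_univ_succ]
  · intro i j hij
    fin_cases i <;> fin_cases j <;> first | exact absurd hij (by decide) | rfl

/-- The matrix with columns `e₀, A e₀, A² e₀`. -/
def krylov {K : Type*} [CommRing K] (A : Matrix (Fin 3) (Fin 3) K) : Matrix (Fin 3) (Fin 3) K :=
  !![1, A 0 0, (A * A) 0 0; 0, A 1 0, (A * A) 1 0; 0, A 2 0, (A * A) 2 0]

theorem nineDefect_eq_zero_of_isUnit_det_krylov {K : Type*} [CommRing K]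
    (A B : Matrix (Fin 3) (Fin 3) K) (htr : A.trace = 0)
    (h : IsUnit (krylov A).det) : nineDefect A B = 0 := by
  set Q := krylov A with hQ
  have h₁ : Q⁻¹ * Q = 1 := Matrix.nonsing_inv_mul Q h
  have h₂ : Q * Q⁻¹ = 1 := Matrix.mul_nonsing_inv Q h
  obtain ⟨w, hw⟩ : ∃ w, Q *ᵥ w = fun i => (A * Q) i 2 :=
    ⟨Q⁻¹ *ᵥ fun i => (A * Q) i 2, by rw [Matrix.mulVec_mulVec, h₂, Matrix.one_mulVec]⟩
  have hAQ : A * Q = Q * !![0, 0, w 0; 1, 0, w 1; 0, 1, w 2] := by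
    ext i j
    fin_cases j
    · fin_cases i <;> simp [hQ, krylov, Matrix.mul_apply, Fin.sum_univ_three]
    · fin_cases i <;> simp [hQ, krylov, Matrix.mul_apply, Fin.sum_univ_three]
    · refine (congrFun hw i).symm.trans ?_
      simp [Matrix.mulVec, dotProduct, Matrix.mul_apply, Fin.sum_univ_three]
  have hA : Q⁻¹ * A * Q = !![0, 0, w 0; 1, 0, w 1; 0, 1, w 2] := by
    rw [mul_assoc, hAQ, ← mul_assoc, h₁, one_mul]
  have hw₂ : w 2 = 0 := by
    have := congrArg Matrix.trace hA
    rwa [mul_assoc, Matrix.trace_mul_comm, mul_assoc, h₂, mul_one, htr, Matrix.trace_fin_three_of,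
      zero_add, zero_add, eq_comm] at this
  rw [← nineDefect_conj A B Q⁻¹ Q h₂, hA, hw₂]
  have := two_mul_vecDet_nineWords_companion (w 0) (w 1) (Q⁻¹ * B * Q)
  rw [nineDefect, vecDet_nine, mul_left_comm, this, sub_self]

theorem nineDefect_eq_zero_of_trace_eq_zero {K : Type*} [Field K] [CharZero K]
    (A B : Matrix (Fin 3) (Fin 3) K) (htr : A.trace = 0) :
    nineDefect A B = 0 := by
  let N : Matrix (Fin 3) (Fin 3) K[X] := !![0, 0, 0; X, 0, 0; 0, X, 0]
  let F : K[X] := nineDefect (C.mapMatrix A + N) (C.mapMatrix B)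
  let G : K[X] := X ^ 3 + C (A 2 1 + 2 * A 1 0) * X ^ 2 +
    C (A 1 0 ^ 2 + 2 * A 1 0 * A 2 1 + A 2 0 * (A 2 2 - A 1 1)) * X + C (krylov A).det
  have hF (t : K) : F.eval t = nineDefect (A + !![0, 0, 0; t, 0, 0; 0, t, 0]) B := by
    rw [← coe_evalRingHom, map_nineDefect]
    congr 1
    · ext i j
      fin_cases i <;> fin_cases j <;> simp [N]
    · ext i j
      simp
  have hG (t : K) : G.eval t = (krylov (A + !![0, 0, 0; t, 0, 0; 0, t, 0])).det := by
    simp [G, krylov, Matrix.det_fin_three, Matrix.mul_apply, Fin.sum_univ_three]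
    ring
  have hG0 : G ≠ 0 := Monic.ne_zero (by simp only [G]; monicity!)
  have hFG : F * G = 0 := by
    refine Polynomial.funext fun t => ?_
    rw [eval_mul, eval_zero, hF, hG, mul_eq_zero]
    by_cases ht : (krylov (A + !![0, 0, 0; t, 0, 0; 0, t, 0])).det = 0
    · exact Or.inr ht
    · exact Or.inl (nineDefect_eq_zero_of_isUnit_det_krylov _ _
        (by simp [htr, Matrix.trace_fin_three]) (isUnit_iff_ne_zero.mpr ht))
  have h0 := hF 0
  rw [(mul_eq_zero.mp hFG).resolve_right hG0, eval_zero] at h0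
  have hN : (!![0, 0, 0; 0, 0, 0; 0, 0, 0] : Matrix (Fin 3) (Fin 3) K) = 0 := by
    ext i j
    fin_cases i <;> fin_cases j <;> rfl
  rw [h0, hN, add_zero]

theorem nineDefect_eq_zero {K : Type*} [Field K] [CharZero K] (A B : Matrix (Fin 3) (Fin 3) K) :
    nineDefect A B = 0 := by
  rw [← nineDefect_sub_smul_one A B (A.trace / 3)]
  refine nineDefect_eq_zero_of_trace_eq_zero _ _ ?_
  simp [Matrix.trace_sub, Matrix.trace_smul]

theorem stmt_4 {K : Type*} [Field K] [CharZero K] (A B : Matrix (Fin 3) (Fin 3) K) :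
    vecDet (nine A B) = -9 * ((A * B - B * A).det) ^ 2 * Hm (A * B - B * A) := by
  have h := nineDefect_eq_zero A B
  have htr : (A * B - B * A).trace = 0 := by
    rw [Matrix.trace_sub, Matrix.trace_mul_comm, sub_self]
  rw [nineDefect] at h
  rw [Hm, htr]
  linear_combination h / 2
end

section
/- Let K be a field of characteristic zero and A, B ∈ M₃(K) with det([A,B]) ≠ 0 and H([A,B]) ≠ 0. Then the span of all words of length at most 3 in A and B (products of at most three factors, each equal to A or B, together with I) equals M₃(K); that is, the generating set {A,B} has length at most 3. -/
open Matrix Polynomial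

open scoped Kronecker

/-- Enumeration of the positions of a 3×3 matrix, diagonal positions first. -/
noncomputable def diagFirst : Fin 3 ⊕ Fin 6 ≃ Fin 3 × Fin 3 :=
  Equiv.ofBijective
    (Sum.elim ![(0, 0), (1, 1), (2, 2)] ![(0, 1), (0, 2), (1, 0), (1, 2), (2, 0), (2, 1)])
    (by decide)

section CommRing

variable {R S : Type*} [CommRing R] [CommRing S]

/-- The words `1, A, A², B, AB, BA, ABA, B², BAB`. -/
def shortWords (A B : Matrix (Fin 3) (Fin 3) R) :
    Fin 3 ⊕ Fin 6 → Matrix (Fin 3) (Fin 3) R :=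
  Sum.elim ![1, A, A * A] ![B, A * B, B * A, A * B * A, B * B, B * A * B]

/-- Determinant of nine 3×3 matrices, regarded as vectors with the positions ordered by
`diagFirst`. -/
noncomputable def positionDet (v : Fin 3 ⊕ Fin 6 → Matrix (Fin 3) (Fin 3) R) : R :=
  Matrix.det (Matrix.of fun p q => v q (diagFirst p).1 (diagFirst p).2)

/-- Twice the determinant of the short words, plus `2 det(C)² H(C)` for `C = [A, B]`. -/
noncomputable def wordDefect (A B : Matrix (Fin 3) (Fin 3) R) : R :=
  2 * positionDet (shortWords A B) +
    (A * B - B * A).det ^ 2 * ((A * B - B * A).trace ^ 2 -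
      ((A * B - B * A) * (A * B - B * A)).trace)

theorem positionDet_conj (P Q : Matrix (Fin 3) (Fin 3) R) (h : P * Q = 1)
    (v : Fin 3 ⊕ Fin 6 → Matrix (Fin 3) (Fin 3) R) :
    positionDet (fun q => P * v q * Q) = positionDet v := by
  have hmul : (Matrix.of fun p q => (P * v q * Q) (diagFirst p).1 (diagFirst p).2) =
      (P ⊗ₖ Qᵀ).submatrix diagFirst diagFirst *
        Matrix.of fun p q => v q (diagFirst p).1 (diagFirst p).2 := by
    ext p q
    rw [Matrix.mul_apply]
    simp only [Matrix.submatrix_apply, Matrix.of_apply]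
    rw [Equiv.sum_comp diagFirst fun r => (P ⊗ₖ Qᵀ) (diagFirst p) r * v q r.1 r.2,
      Fintype.sum_prod_type]
    simp only [Matrix.mul_apply, Matrix.kroneckerMap_apply, Matrix.transpose_apply, Finset.sum_mul]
    rw [Finset.sum_comm]
    refine Finset.sum_congr rfl fun i _ => Finset.sum_congr rfl fun j _ => by ring
  have hPQ : P.det * Q.det = 1 := by rw [← Matrix.det_mul, h, Matrix.det_one]
  unfold positionDet
  rw [hmul, Matrix.det_mul, Matrix.det_submatrix_equiv_self, Matrix.det_kronecker,
    Matrix.det_transpose, ← mul_pow, hPQ, one_pow, one_mul]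

theorem shortWords_conj (P Q A B : Matrix (Fin 3) (Fin 3) R) (hPQ : P * Q = 1)
    (hQP : Q * P = 1) :
    shortWords (P * A * Q) (P * B * Q) = fun q => P * shortWords A B q * Q := by
  have key (X Y : Matrix (Fin 3) (Fin 3) R) : P * X * Q * (P * Y * Q) = P * (X * Y) * Q := by
    calc P * X * Q * (P * Y * Q) = P * X * (Q * P) * Y * Q := by simp only [mul_assoc]
      _ = P * (X * Y) * Q := by rw [hQP, mul_one]; simp only [mul_assoc]
  funext q
  rcases q with q | q <;> fin_cases q <;> simp [shortWords, key, hPQ]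

theorem wordDefect_conj (P Q A B : Matrix (Fin 3) (Fin 3) R) (hPQ : P * Q = 1)
    (hQP : Q * P = 1) :
    wordDefect (P * A * Q) (P * B * Q) = wordDefect A B := by
  have key (X Y : Matrix (Fin 3) (Fin 3) R) : P * X * Q * (P * Y * Q) = P * (X * Y) * Q := by
    calc P * X * Q * (P * Y * Q) = P * X * (Q * P) * Y * Q := by simp only [mul_assoc]
      _ = P * (X * Y) * Q := by rw [hQP, mul_one]; simp only [mul_assoc]
  have htr (X : Matrix (Fin 3) (Fin 3) R) : (P * X * Q).trace = X.trace := by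
    rw [Matrix.trace_mul_comm, ← mul_assoc, hQP, one_mul]
  have hdet (X : Matrix (Fin 3) (Fin 3) R) : (P * X * Q).det = X.det := by
    rw [Matrix.det_mul_comm, ← mul_assoc, hQP, one_mul]
  unfold wordDefect
  rw [shortWords_conj P Q A B hPQ hQP, positionDet_conj P Q hPQ, key, key, ← sub_mul, ← mul_sub,
    key, hdet, htr, htr]

theorem wordDefect_map (φ : R →+* S) (A B : Matrix (Fin 3) (Fin 3) R) :
    wordDefect (A.map φ) (B.map φ) = φ (wordDefect A B) := by
  have hpos : positionDet (shortWords (A.map φ) (B.map φ)) =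
      φ (positionDet (shortWords A B)) := by
    unfold positionDet
    rw [RingHom.map_det]
    congr 1
    ext p q
    rcases q with q | q <;> fin_cases q <;>
      simp [shortWords, ← Matrix.map_mul, Matrix.one_apply, apply_ite φ]
  have htr (X : Matrix (Fin 3) (Fin 3) R) : (X.map φ).trace = φ X.trace :=
    (AddMonoidHom.map_trace φ X).symm
  have hdet (X : Matrix (Fin 3) (Fin 3) R) : (X.map φ).det = φ X.det :=
    (φ.map_det X).symm
  have hC : A.map φ * B.map φ - B.map φ * A.map φ = (A * B - B * A).map φ := by
    rw [Matrix.map_sub φ (map_sub φ), Matrix.map_mul, Matrix.map_mul]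
  unfold wordDefect
  rw [hpos, hC, ← Matrix.map_mul, hdet, htr, htr]
  simp only [map_add, map_mul, map_sub, map_pow, map_ofNat]

theorem det_offDiagonal (x y z d0 d1 d2 b01 b02 b10 b12 b20 b21 : R) :
    Matrix.det
      !![b01, x*b01, y*b01, x*y*b01, (d0+d1)*b01+b02*b21, (d0*x+d1*y)*b01+b02*z*b21;
         b02, x*b02, z*b02, x*z*b02, (d0+d2)*b02+b01*b12, (d0*x+d2*z)*b02+b01*y*b12;
         b10, y*b10, x*b10, y*x*b10, (d1+d0)*b10+b12*b20, (d1*y+d0*x)*b10+b12*z*b20;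
         b12, y*b12, z*b12, y*z*b12, (d1+d2)*b12+b10*b02, (d1*y+d2*z)*b12+b10*x*b02;
         b20, z*b20, x*b20, z*x*b20, (d2+d0)*b20+b21*b10, (d2*z+d0*x)*b20+b21*y*b10;
         b21, z*b21, y*b21, z*y*b21, (d2+d1)*b21+b20*b01, (d2*z+d1*y)*b21+b20*x*b01] =
    (y - x) * (z - x) * (y - z) * (b01 * b12 * b20 - b02 * b21 * b10) ^ 2 *
      ((x - y) ^ 2 * b01 * b10 + (x - z) ^ 2 * b02 * b20 + (y - z) ^ 2 * b12 * b21) := by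
  simp [Matrix.det_succ_row_zero, Fin.sum_univ_succ, Fin.succAbove]
  ring

theorem wordDefect_diagonal (a : Fin 3 → R) (B : Matrix (Fin 3) (Fin 3) R) :
    wordDefect (Matrix.diagonal a) B = 0 := by
  have hblocks : (Matrix.of fun p q =>
        shortWords (Matrix.diagonal a) B q (diagFirst p).1 (diagFirst p).2) =
      Matrix.fromBlocks (Matrix.vandermonde a)
        (Matrix.of fun p q =>
          shortWords (Matrix.diagonal a) B (Sum.inr q) (diagFirst (Sum.inl p)).1
            (diagFirst (Sum.inl p)).2)
        0
        (Matrix.of fun p q =>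
          shortWords (Matrix.diagonal a) B (Sum.inr q) (diagFirst (Sum.inr p)).1
            (diagFirst (Sum.inr p)).2) := by
    ext p q
    rcases p with p | p <;> rcases q with q | q <;> try rfl
    · fin_cases p <;> fin_cases q <;> simp [shortWords, diagFirst, Matrix.vandermonde_apply, sq]
    · fin_cases p <;> fin_cases q <;> simp [shortWords, diagFirst]
  have hoff : (Matrix.of fun p q =>
          shortWords (Matrix.diagonal a) B (Sum.inr q) (diagFirst (Sum.inr p)).1
            (diagFirst (Sum.inr p)).2).det =
      (a 1 - a 0) * (a 2 - a 0) * (a 1 - a 2) *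
        (B 0 1 * B 1 2 * B 2 0 - B 0 2 * B 2 1 * B 1 0) ^ 2 *
        ((a 0 - a 1) ^ 2 * B 0 1 * B 1 0 + (a 0 - a 2) ^ 2 * B 0 2 * B 2 0 +
          (a 1 - a 2) ^ 2 * B 1 2 * B 2 1) := by
    rw [← det_offDiagonal _ _ _ (B 0 0) (B 1 1) (B 2 2)]
    congr 1
    ext p q
    fin_cases p <;> fin_cases q <;>
      simp [shortWords, diagFirst, Matrix.mul_apply, Fin.sum_univ_three, Matrix.diagonal_apply] <;>
      ring
  unfold wordDefect positionDet
  rw [hblocks, Matrix.det_fromBlocks_zero₂₁, hoff]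
  simp [Matrix.det_fin_three, Matrix.trace_fin_three, Matrix.vandermonde_apply, Matrix.mul_apply,
    Fin.sum_univ_three, Matrix.diagonal_apply]
  ring

/-- The characteristic polynomial of a 3×3 matrix, as a cubic. -/
def charCubic (A : Matrix (Fin 3) (Fin 3) R) : Cubic R where
  a := 1
  b := -A.trace
  c := A 0 0 * A 1 1 - A 0 1 * A 1 0 + (A 0 0 * A 2 2 - A 0 2 * A 2 0) +
    (A 1 1 * A 2 2 - A 1 2 * A 2 1)
  d := -A.det

theorem eval_charCubic (A : Matrix (Fin 3) (Fin 3) R) (x : R) :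
    (charCubic A).toPoly.eval x = (Matrix.scalar (Fin 3) x - A).det := by
  simp [charCubic, Cubic.toPoly, Matrix.det_fin_three, Matrix.trace_fin_three]
  ring

theorem discr_charCubic_map (φ : R →+* S) (A : Matrix (Fin 3) (Fin 3) R) :
    (charCubic (A.map φ)).discr = φ (charCubic A).discr := by
  simp only [charCubic, Cubic.discr, Matrix.det_fin_three, Matrix.trace_fin_three,
    Matrix.map_apply, map_add, map_mul, map_sub, map_pow, map_neg, map_one, map_ofNat]

end CommRing

section AlgClosed

variable {L : Type*} [Field L] [IsAlgClosed L]

theorem exists_conj_diagonal_of_discr_ne_zero (A : Matrix (Fin 3) (Fin 3) L)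
    (h : (charCubic A).discr ≠ 0) :
    ∃ (P Q : Matrix (Fin 3) (Fin 3) L) (a : Fin 3 → L),
      P * Q = 1 ∧ Q * P = 1 ∧ A = P * Matrix.diagonal a * Q := by
  have ha : (charCubic A).a ≠ 0 := one_ne_zero
  obtain ⟨x, y, z, hroots⟩ := (Cubic.splits_iff_roots_eq_three (φ := RingHom.id L) ha).1
    (IsAlgClosed.splits _)
  obtain ⟨hxy, hxz, hyz⟩ := (Cubic.discr_ne_zero_iff_roots_ne ha hroots).1 h
  let a : Fin 3 → L := ![x, y, z]
  have hinj : Function.Injective a := by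
    intro i j hij
    fin_cases i <;> fin_cases j <;> simp_all [a]
  have hvec (i : Fin 3) : ∃ v : Fin 3 → L, v ≠ 0 ∧ A *ᵥ v = a i • v := by
    have hmem : a i ∈ (Cubic.map (RingHom.id L) (charCubic A)).roots := by
      rw [hroots]
      fin_cases i <;> simp [a]
    have hdet : (Matrix.scalar (Fin 3) (a i) - A).det = 0 := by
      rw [← eval_charCubic]
      rw [Cubic.map_roots, Polynomial.map_id] at hmem
      exact Polynomial.isRoot_of_mem_roots hmem
    obtain ⟨v, hv, hv0⟩ := Matrix.exists_mulVec_eq_zero_iff.2 hdet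
    refine ⟨v, hv, ?_⟩
    rw [Matrix.sub_mulVec, sub_eq_zero] at hv0
    rw [← hv0]
    ext j
    simp [Matrix.scalar_apply, Matrix.mulVec_diagonal]
  choose v hv0 hv using hvec
  have hli : LinearIndependent L v :=
    Module.End.eigenvectors_linearIndependent' (Matrix.toLin' A) a hinj v fun i =>
      ⟨Module.End.mem_eigenspace_iff.2 (by simpa using hv i), hv0 i⟩
  let P : Matrix (Fin 3) (Fin 3) L := (Matrix.of v)ᵀ
  have hP : IsUnit P :=
    (Matrix.isUnit_transpose _).2 (Matrix.linearIndependent_rows_iff_isUnit.1 hli)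
  have hPdet : IsUnit P.det := (Matrix.isUnit_iff_isUnit_det P).1 hP
  refine ⟨P, P⁻¹, a, Matrix.mul_nonsing_inv P hPdet, Matrix.nonsing_inv_mul P hPdet, ?_⟩
  have hAP : A * P = P * Matrix.diagonal a := by
    ext i j
    rw [Matrix.mul_diagonal]
    have := congrFun (hv j) i
    simpa [P, Matrix.mul_apply, Matrix.mulVec, dotProduct, mul_comm] using this
  rw [← hAP, mul_assoc, Matrix.mul_nonsing_inv P hPdet, mul_one]

theorem wordDefect_eq_zero_of_discr_ne_zero (A B : Matrix (Fin 3) (Fin 3) L)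
    (h : (charCubic A).discr ≠ 0) : wordDefect A B = 0 := by
  obtain ⟨P, Q, a, hPQ, hQP, rfl⟩ := exists_conj_diagonal_of_discr_ne_zero A h
  have hB : B = P * (Q * B * P) * Q := by
    calc B = (P * Q) * B * (P * Q) := by rw [hPQ, one_mul, mul_one]
      _ = P * (Q * B * P) * Q := by simp only [mul_assoc]
  rw [hB, wordDefect_conj P Q _ _ hPQ hQP, wordDefect_diagonal]

theorem wordDefect_eq_zero_of_isAlgClosed [CharZero L] (A B : Matrix (Fin 3) (Fin 3) L) :
    wordDefect A B = 0 := by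
  let E : Matrix (Fin 3) (Fin 3) L := Matrix.diagonal ![0, 1, 2]
  let A' : Matrix (Fin 3) (Fin 3) L[X] := A.map C + (X : L[X]) • (E - A).map C
  have heval (t : L) : A'.map (evalRingHom t) = A + t • (E - A) := by
    ext i j
    simp [A', Matrix.map_apply]
  have hevalB (t : L) : (B.map C).map (evalRingHom t) = B := by
    ext i j
    simp [Matrix.map_apply]
  have hprod : wordDefect A' (B.map C) * (charCubic A').discr = 0 := by
    refine Polynomial.funext fun t => ?_
    rw [eval_mul, eval_zero, ← coe_evalRingHom, ← wordDefect_map, ← discr_charCubic_map, hevalB]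
    by_cases h : (charCubic (A'.map (evalRingHom t))).discr = 0
    · rw [h, mul_zero]
    · rw [wordDefect_eq_zero_of_discr_ne_zero _ _ h, zero_mul]
  have hdiscr : (charCubic A').discr ≠ 0 := by
    intro h
    have h1 := discr_charCubic_map (evalRingHom 1) A'
    rw [h, map_zero, heval, one_smul, add_sub_cancel] at h1
    simp [E, charCubic, Cubic.discr, Fin.sum_univ_three, Fin.prod_univ_three] at h1
    norm_num at h1
  have h0 := wordDefect_map (evalRingHom 0) A' (B.map C)
  rw [(mul_eq_zero.1 hprod).resolve_right hdiscr, map_zero, heval, hevalB] at h0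
  simpa using h0

end AlgClosed

theorem wordDefect_eq_zero {K : Type*} [Field K] [CharZero K]
    (A B : Matrix (Fin 3) (Fin 3) K) : wordDefect A B = 0 := by
  have : CharZero (AlgebraicClosure K) :=
    charZero_of_injective_algebraMap (algebraMap K (AlgebraicClosure K)).injective
  apply (algebraMap K (AlgebraicClosure K)).injective
  rw [← wordDefect_map, map_zero, wordDefect_eq_zero_of_isAlgClosed]

theorem span_range_eq_top_of_positionDet_ne_zero {K : Type*} [Field K]
    (v : Fin 3 ⊕ Fin 6 → Matrix (Fin 3) (Fin 3) K) (h : positionDet v ≠ 0) :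
    Submodule.span K (Set.range v) = ⊤ := by
  rw [eq_top_iff]
  intro M _
  let W : Matrix (Fin 3 ⊕ Fin 6) (Fin 3 ⊕ Fin 6) K :=
    Matrix.of fun p q => v q (diagFirst p).1 (diagFirst p).2
  let m : Fin 3 ⊕ Fin 6 → K := fun p => M (diagFirst p).1 (diagFirst p).2
  have hW : W *ᵥ (W⁻¹ *ᵥ m) = m := by
    rw [Matrix.mulVec_mulVec, Matrix.mul_nonsing_inv W (isUnit_iff_ne_zero.2 h),
      Matrix.one_mulVec]
  have hM : M = ∑ q, (W⁻¹ *ᵥ m) q • v q := by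
    ext i j
    have := congrFun hW (diagFirst.symm (i, j))
    simp only [W, m, Matrix.mulVec, dotProduct, Matrix.of_apply, Equiv.apply_symm_apply] at this
    rw [← this, Matrix.sum_apply]
    refine Finset.sum_congr rfl fun q _ => ?_
    simp [Matrix.mulVec, dotProduct, W, m, mul_comm]
  rw [hM]
  exact Submodule.sum_mem _ fun q _ =>
    Submodule.smul_mem _ _ (Submodule.subset_span ⟨q, rfl⟩)

theorem stmt_6 {K : Type*} [Field K] [CharZero K] (A B : Matrix (Fin 3) (Fin 3) K)
    (hdet : (A * B - B * A).det ≠ 0) (hH : Hm (A * B - B * A) ≠ 0) :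
    Submodule.span K {M : Matrix (Fin 3) (Fin 3) K |
      ∃ l : List (Matrix (Fin 3) (Fin 3) K),
        l.length ≤ 3 ∧ (∀ X ∈ l, X = A ∨ X = B) ∧ M = l.prod} = ⊤ := by
  have hpos : positionDet (shortWords A B) ≠ 0 := by
    intro h
    have hz := wordDefect_eq_zero A B
    unfold wordDefect at hz
    rw [h, mul_zero, zero_add] at hz
    refine hH ?_
    rw [Hm, (mul_eq_zero.1 hz).resolve_left (pow_ne_zero 2 hdet), zero_div]
  rw [eq_top_iff, ← span_range_eq_top_of_positionDet_ne_zero _ hpos]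
  refine Submodule.span_mono ?_
  rintro _ ⟨q, rfl⟩
  rcases q with q | q <;> fin_cases q
  · exact ⟨[], by simp, by simp, by simp [shortWords]⟩
  · exact ⟨[A], by simp, by simp, by simp [shortWords]⟩
  · exact ⟨[A, A], by simp, by simp, by simp [shortWords]⟩
  · exact ⟨[B], by simp, by simp, by simp [shortWords]⟩
  · exact ⟨[A, B], by simp, by simp, by simp [shortWords]⟩
  · exact ⟨[B, A], by simp, by simp, by simp [shortWords]⟩
  · exact ⟨[A, B, A], by simp, by simp, by simp [shortWords, mul_assoc]⟩
  · exact ⟨[B, B], by simp, by simp, by simp [shortWords]⟩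
  · exact ⟨[B, A, B], by simp, by simp, by simp [shortWords, mul_assoc]⟩
end

section
/- Let A, B ∈ M₃(K), K a field of characteristic zero, with C = [A,B] satisfying det(C) ≠ 0 and H(C) ≠ 0. Then A and B generate M₃(K) as a unital K-algebra. -/
open Matrix Polynomial

/-- **Burnside's theorem** on matrix algebras: over an algebraically closed field, a subalgebra of
`End V` without nontrivial invariant subspaces is all of `End V`. -/
theorem Subalgebra.eq_top_of_forall_invariant {L V : Type*} [Field L] [IsAlgClosed L]
    [AddCommGroup V] [Module L V] [FiniteDimensional L V] [Nontrivial V]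
    (S : Subalgebra L (Module.End L V))
    (h : ∀ W : Submodule L V, (∀ s ∈ S, ∀ w ∈ W, s w ∈ W) → W = ⊥ ∨ W = ⊤) : S = ⊤ := by
  have hsimple : IsSimpleModule S V := by
    refine (isSimpleModule_iff ..).2 { eq_bot_or_eq_top := fun W => ?_ }
    have := h (W.restrictScalars L) fun s hs w hw => W.smul_mem (⟨s, hs⟩ : S) hw
    simpa using this
  refine eq_top_iff.2 fun f _ => ?_
  have hf (c : Module.End S V) (v : V) : f (c v) = c (f v) := by
    obtain ⟨t, rfl⟩ :=
      (IsSimpleModule.algebraMap_end_bijective_of_isAlgClosed (A := S) (V := V) L).2 c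
    simp
  let F : Module.End (Module.End S V) V :=
    { toFun := f, map_add' := map_add f, map_smul' := hf }
  obtain ⟨b⟩ : Nonempty (Module.Basis (Fin (Module.finrank L V)) L V) := ⟨Module.finBasis L V⟩
  classical
  obtain ⟨r, hr⟩ := jacobson_density F (Finset.univ.image b)
  have : f = r := b.ext fun i => hr _ (Finset.mem_image_of_mem _ (Finset.mem_univ i))
  exact this ▸ r.2

/-- If linear maps `f` and `g` on a three-dimensional space have a common nontrivial invariant
subspace, their commutator is singular. -/
theorem LinearMap.eq_bot_or_eq_top_of_bijective_commutator {L V : Type*} [Field L]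
    [AddCommGroup V] [Module L V] (hV : Module.finrank L V = 3) (f g : Module.End L V)
    (hfg : Function.Bijective (f * g - g * f)) (W : Submodule L V)
    (hf : ∀ w ∈ W, f w ∈ W) (hg : ∀ w ∈ W, g w ∈ W) : W = ⊥ ∨ W = ⊤ := by
  have : FiniteDimensional L V := .of_finrank_pos (by omega)
  have hsum := W.finrank_quotient_add_finrank
  by_contra! hW
  have hpos : 0 < Module.finrank L W := by
    rw [Nat.pos_iff_ne_zero]
    exact fun h0 => hW.1 (Submodule.finrank_eq_zero.1 h0)
  have hlt : Module.finrank L W < 3 := hV ▸ Submodule.finrank_lt hW.2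
  obtain h1 | h2 : Module.finrank L W = 1 ∨ Module.finrank L (V ⧸ W) = 1 := by omega
  · have hc : Commute (f.restrict hf) (g.restrict hg) := by
      obtain ⟨a, ha⟩ := LinearMap.existsUnique_eq_smul_id_of_finrank_eq_one h1 (f.restrict hf)
      rw [ha.1]
      exact (Commute.one_left _).smul_left a
    obtain ⟨w, hw, hw0⟩ := W.exists_mem_ne_zero_of_ne_bot hW.1
    refine hw0 (hfg.1 ?_)
    have := congr(($hc.eq ⟨w, hw⟩ : V))
    simpa [sub_eq_zero] using this
  · have hc : Commute (W.mapQ W f hf) (W.mapQ W g hg) := by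
      obtain ⟨a, ha⟩ := LinearMap.existsUnique_eq_smul_id_of_finrank_eq_one h2 (W.mapQ W f hf)
      rw [ha.1]
      exact (Commute.one_left _).smul_left a
    refine hW.2 (eq_top_iff.2 fun v _ => ?_)
    obtain ⟨u, rfl⟩ := hfg.2 v
    have := congr($hc.eq (W.mkQ u))
    simpa [← Submodule.Quotient.mk_sub, sub_eq_zero, Submodule.Quotient.eq] using this

/-- A set of matrices over `K` which generates the full matrix algebra over an extension field
already does so over `K`. -/
theorem Matrix.adjoin_eq_top_of_adjoin_map_eq_top {K L n : Type*} [Field K] [Field L] [Algebra K L]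
    [Fintype n] [DecidableEq n] (s : Set (Matrix n n K))
    (h : Algebra.adjoin L ((algebraMap K L).mapMatrix '' s) = (⊤ : Subalgebra L (Matrix n n L))) :
    Algebra.adjoin K s = ⊤ := by
  rw [← Algebra.toSubmodule_eq_top]
  by_contra hs
  obtain ⟨f, hf0, hf⟩ := Submodule.exists_dual_map_eq_bot_of_lt_top (lt_top_iff_ne_top.2 hs)
    inferInstance
  let F : Matrix n n L →ₗ[L] L :=
    ∑ i, ∑ j, algebraMap K L (f (Matrix.single i j 1)) • Matrix.entryLinearMap L L i j
  have hF (M : Matrix n n K) : F ((algebraMap K L).mapMatrix M) = algebraMap K L (f M) := by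
    conv_rhs => rw [Matrix.matrix_eq_sum_single M]
    have (i j : n) : f (Matrix.single i j (M i j)) = f (Matrix.single i j 1) * M i j := by
      rw [mul_comm, ← smul_eq_mul, ← map_smul, Matrix.smul_single, smul_eq_mul, mul_one]
    simp [F, this, Algebra.smul_def]
  have hle : (⊤ : Submodule L (Matrix n n L)) ≤ LinearMap.ker F := by
    rw [← Algebra.top_toSubmodule, ← h, Algebra.adjoin_eq_span, Submodule.span_le]
    have hcl : Submonoid.closure ((algebraMap K L).mapMatrix '' s) =
        (Submonoid.closure s).map ((algebraMap K L).mapMatrix : Matrix n n K →+* Matrix n n L) :=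
      (MonoidHom.map_mclosure _ s).symm
    rw [hcl]
    rintro _ ⟨M, hM, rfl⟩
    have hM' : f M = 0 := by
      have : f M ∈ (Subalgebra.toSubmodule (Algebra.adjoin K s)).map f :=
        Submodule.mem_map_of_mem (Algebra.adjoin_eq_span K s ▸ Submodule.subset_span hM)
      simpa [hf] using this
    simpa [hM'] using hF M
  refine hf0 (LinearMap.ext fun M => (algebraMap K L).injective ?_)
  rw [← hF]
  simpa using hle (Submodule.mem_top (x := (algebraMap K L).mapMatrix M))

/-- Over an algebraically closed field, two `3 × 3` matrices with invertible commutator generate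
the full matrix algebra. -/
theorem Matrix.adjoin_pair_eq_top_of_det_commutator_ne_zero {L : Type*} [Field L] [IsAlgClosed L]
    (A B : Matrix (Fin 3) (Fin 3) L) (h : (A * B - B * A).det ≠ 0) :
    Algebra.adjoin L {A, B} = (⊤ : Subalgebra L (Matrix (Fin 3) (Fin 3) L)) := by
  let e : Matrix (Fin 3) (Fin 3) L ≃ₐ[L] Module.End L (Fin 3 → L) := Matrix.toLinAlgEquiv'
  have hbij : Function.Bijective (e A * e B - e B * e A) := by
    rw [← map_mul, ← map_mul, ← map_sub, ← Module.End.isUnit_iff]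
    exact ((Matrix.isUnit_iff_isUnit_det _).2 h.isUnit).map e
  have htop : (Algebra.adjoin L {A, B}).map (e : _ →ₐ[L] Module.End L (Fin 3 → L)) = ⊤ := by
    refine Subalgebra.eq_top_of_forall_invariant _ fun W hW => ?_
    refine LinearMap.eq_bot_or_eq_top_of_bijective_commutator (by simp) _ _ hbij W
      (hW _ ⟨A, Algebra.subset_adjoin (by simp), rfl⟩)
      (hW _ ⟨B, Algebra.subset_adjoin (by simp), rfl⟩)
  refine eq_top_iff.2 fun M _ => ?_
  obtain ⟨N, hN, hNM⟩ := htop.ge (Algebra.mem_top (x := e M))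
  exact e.injective hNM ▸ hN

theorem stmt_12 {K : Type*} [Field K] [CharZero K] (A B : Matrix (Fin 3) (Fin 3) K)
    (hdet : (A * B - B * A).det ≠ 0) (hH : Hm (A * B - B * A) ≠ 0) :
    Algebra.adjoin K {A, B} = (⊤ : Subalgebra K (Matrix (Fin 3) (Fin 3) K)) := by
  apply Matrix.adjoin_eq_top_of_adjoin_map_eq_top (L := AlgebraicClosure K)
  rw [Set.image_pair]
  apply Matrix.adjoin_pair_eq_top_of_det_commutator_ne_zero
  rw [← map_mul, ← map_mul, ← map_sub, ← RingHom.map_det]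
  exact (_root_.map_ne_zero _).2 hdet
end

section
/- For 3×3 matrices A, B over a commutative ring, both sides of the identity det(I,A,A²,B,B²,AB,BA,[A,[A,B]],[B,[B,A]]) = −9(det[A,B])²H([A,B]) vanish whenever [A,B] is not invertible; in particular if det([A,B]) = 0 then the nine matrices I, A, A², B, B², AB, BA, [A,[A,B]], [B,[B,A]] are linearly dependent. -/
open Matrix Polynomial

/-- A vector `u` coplanar with two independent vectors of a three-dimensional space is a linear
combination of them. -/
lemma exists_eq_smul_add_smul_of_det_eq_zero {K : Type*} [Field K] {c d u : Fin 3 → K}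
    (hdet : (Matrix.of ![c, d, u]).det = 0) (hind : LinearIndependent K ![c, d]) :
    ∃ s t : K, u = s • c + t • d := by
  obtain ⟨g, hg, hgu⟩ := Matrix.exists_vecMul_eq_zero_iff.mpr hdet
  have hsum : g 0 • c + g 1 • d + g 2 • u = 0 := by
    rw [Matrix.vecMul_eq_sum, Fin.sum_univ_three] at hgu
    exact hgu
  have hg2 : g 2 ≠ 0 := by
    intro h
    rw [h, zero_smul, add_zero] at hsum
    obtain ⟨h0, h1⟩ := LinearIndependent.pair_iff.mp hind _ _ hsum
    apply hg
    ext i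
    fin_cases i <;> assumption
  refine ⟨-(g 0 / g 2), -(g 1 / g 2), ?_⟩
  ext i
  have hi := congrFun hsum i
  simp only [Pi.add_apply, Pi.smul_apply, smul_eq_mul, Pi.zero_apply] at hi ⊢
  field_simp
  linear_combination hi

/-- A 3×3 matrix killing two independent vectors has rank at most one, so its square is a multiple
of it. -/
lemma exists_mul_self_eq_smul {K : Type*} [Field K] {N : Matrix (Fin 3) (Fin 3) K}
    {v z : Fin 3 → K} (hv : N *ᵥ v = 0) (hz : N *ᵥ z = 0) (hvz : LinearIndependent K ![v, z]) :
    ∃ t : K, N * N = t • N := by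
  set w := crossProduct v z with hw
  have hprop : ∀ i j k, N i j * w k = N i k * w j := by
    intro i j k
    have h1 := congrFun hv i
    have h2 := congrFun hz i
    simp only [Matrix.mulVec, dotProduct, Fin.sum_univ_three, Pi.zero_apply] at h1 h2
    fin_cases j <;> fin_cases k <;> simp [hw, cross_apply]
    · linear_combination v 2 * h2 - z 2 * h1
    · linear_combination z 1 * h1 - v 1 * h2
    · linear_combination z 2 * h1 - v 2 * h2
    · linear_combination v 0 * h2 - z 0 * h1
    · linear_combination v 1 * h2 - z 1 * h1
    · linear_combination z 0 * h1 - v 0 * h2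
  obtain ⟨k, hk⟩ : ∃ k, w k ≠ 0 :=
    Function.ne_iff.mp (crossProduct_ne_zero_iff_linearIndependent.mpr hvz)
  have hN : N = vecMulVec (fun i => N i k / w k) w := by
    ext i j
    rw [vecMulVec_apply, div_mul_eq_mul_div, eq_div_iff hk, hprop]
  rw [hN, vecMulVec_mul_vecMulVec, vecMulVec_smul]
  exact ⟨_, rfl⟩

lemma sum_smul_nine {K : Type*} [CommRing K] (A B : Matrix (Fin 3) (Fin 3) K)
    (a₀ a₁ a₂ a₃ a₄ a₅ a₆ a₇ a₈ : K) :
    ∑ i, ![a₀, a₁, a₂, a₃, a₄, a₅, a₆, a₇, a₈] i • nine A B i =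
      a₀ • 1 + a₁ • A + a₂ • A ^ 2 + a₃ • B + a₄ • B ^ 2 + a₅ • (A * B) + a₆ • (B * A) +
        a₇ • (A * (A * B - B * A) - (A * B - B * A) * A) +
        a₈ • (B * (B * A - A * B) - (B * A - A * B) * B) := by
  simp only [Fin.sum_univ_succ, nine]
  simp
  abel

set_option maxHeartbeats 4000000 in
/-- The nine matrices are dependent if the commutator kills a vector `v` such that `v, Av, Bv`
is a basis: the matrices with respect to this basis. -/
lemma not_linearIndependent_nine_normalForm {K : Type*} [Field K] (x₁ x₂ x₃ y₁ y₂ y₃ p₁ p₂ p₃ : K) :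
    ¬ LinearIndependent K
      (nine !![0, x₁, p₁; 1, x₂, p₂; 0, x₃, p₃] !![0, p₁, y₁; 0, p₂, y₂; 1, p₃, y₃]) := by
  set A := !![0, x₁, p₁; 1, x₂, p₂; 0, x₃, p₃] with hA
  set B := !![0, p₁, y₁; 0, p₂, y₂; 1, p₃, y₃] with hB
  obtain ⟨c₁, hc₁⟩ : ∃ c, c = x₁ * p₂ + p₁ * p₃ - p₁ * x₂ - y₁ * x₃ := ⟨_, rfl⟩
  obtain ⟨c₂, hc₂⟩ : ∃ c, c = p₁ + p₂ * p₃ - y₂ * x₃ := ⟨_, rfl⟩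
  obtain ⟨c₃, hc₃⟩ : ∃ c, c = x₃ * p₂ + p₃ * p₃ - x₁ - p₃ * x₂ - y₃ * x₃ := ⟨_, rfl⟩
  obtain ⟨d₁, hd₁⟩ : ∃ d, d = x₁ * y₂ + p₁ * y₃ - p₁ * p₂ - y₁ * p₃ := ⟨_, rfl⟩
  obtain ⟨d₂, hd₂⟩ : ∃ d, d = y₁ + x₂ * y₂ + p₂ * y₃ - p₂ * p₂ - y₂ * p₃ := ⟨_, rfl⟩
  have hcomm : A * B - B * A = !![0, c₁, d₁; 0, c₂, d₂; 0, c₃, -c₂] := by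
    rw [hA, hB, hc₁, hc₂, hc₃, hd₁, hd₂]
    ext i j
    fin_cases i <;> fin_cases j <;> simp <;> ring
  have hAA : A ^ 2 - x₁ • 1 - x₂ • A - x₃ • B = !![0, 0, c₁; 0, 0, c₂; 0, 0, c₃] := by
    rw [hA, hB, hc₁, hc₂, hc₃]
    ext i j
    fin_cases i <;> fin_cases j <;> simp [pow_two, Matrix.one_fin_three] <;> ring
  have hAB : A * B - p₁ • 1 - p₂ • A - p₃ • B = !![0, 0, d₁; 0, 0, d₂; 0, 0, -c₂] := by
    rw [hA, hB, hc₂, hd₁, hd₂]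
    ext i j
    fin_cases i <;> fin_cases j <;> simp [Matrix.one_fin_three] <;> ring
  have hBA : B * A - p₁ • 1 - p₂ • A - p₃ • B = !![0, -c₁, 0; 0, -c₂, 0; 0, -c₃, 0] := by
    rw [hA, hB, hc₁, hc₂, hc₃]
    ext i j
    fin_cases i <;> fin_cases j <;> simp [Matrix.one_fin_three] <;> ring
  have hBB : B ^ 2 - y₁ • 1 - y₂ • A - y₃ • B = !![0, -d₁, 0; 0, -d₂, 0; 0, c₂, 0] := by
    rw [hA, hB, hc₂, hd₁, hd₂]
    ext i j
    fin_cases i <;> fin_cases j <;> simp [pow_two, Matrix.one_fin_three] <;> ring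
  rw [Fintype.not_linearIndependent_iff]
  by_cases hcd : LinearIndependent K ![![c₁, c₂, c₃], ![d₁, d₂, -c₂]]
  · obtain ⟨s, t, h₁⟩ := exists_eq_smul_add_smul_of_det_eq_zero
      (u := ![x₁ * c₂ + p₁ * c₃, c₁ + x₂ * c₂ + p₂ * c₃, x₃ * c₂ + p₃ * c₃])
      (by
        simp [Matrix.det_fin_three]
        rw [hc₁, hc₂, hc₃, hd₁, hd₂]
        ring) hcd
    obtain ⟨s', t', h₂⟩ := exists_eq_smul_add_smul_of_det_eq_zero
      (u := ![x₁ * d₂ - p₁ * c₂ + (p₁ * c₂ + y₁ * c₃),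
        d₁ + x₂ * d₂ - p₂ * c₂ + (p₂ * c₂ + y₂ * c₃),
        x₃ * d₂ - p₃ * c₂ + (c₁ + p₃ * c₂ + y₃ * c₃)])
      (by
        simp [Matrix.det_fin_three]
        rw [hc₁, hc₂, hc₃, hd₁, hd₂]
        ring) hcd
    refine ⟨![c₁ - (2 * s - x₂) * p₁ - (2 * t - x₃) * y₁ + (s' - p₂) * x₁ + (t' - p₃) * p₁,
      c₂ - (2 * s - x₂) * p₂ - (2 * t - x₃) * y₂ + (s' - p₂) * x₂ + (t' - p₃) * p₂,
      -(s' - p₂),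
      c₃ - (2 * s - x₂) * p₃ - (2 * t - x₃) * y₃ + (s' - p₂) * x₃ + (t' - p₃) * p₃,
      2 * t - x₃, -(t' - p₃), 2 * s - x₂, 1, 0], ?_, 7, one_ne_zero⟩
    simp only [Matrix.smul_cons, Matrix.smul_empty, smul_eq_mul, Matrix.cons_add_cons,
      Matrix.empty_add_empty, Matrix.vecCons_inj, and_true] at h₁ h₂
    obtain ⟨e₁₀, e₁₁, e₁₂⟩ := h₁
    obtain ⟨e₂₀, e₂₁, e₂₂⟩ := h₂
    have hAC : A * (A * B - B * A) - (A * B - B * A) * A + c₁ • 1 + c₂ • A + c₃ • B =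
        !![0, (2 * s - x₂) * c₁ + (2 * t - x₃) * d₁, (s' - p₂) * c₁ + (t' - p₃) * d₁;
          0, (2 * s - x₂) * c₂ + (2 * t - x₃) * d₂, (s' - p₂) * c₂ + (t' - p₃) * d₂;
          0, (2 * s - x₂) * c₃ - (2 * t - x₃) * c₂, (s' - p₂) * c₃ - (t' - p₃) * c₂] := by
      rw [hcomm, hA, hB]
      ext i j
      fin_cases i <;> fin_cases j <;> simp [Matrix.one_fin_three]
      · linear_combination 2 * e₁₀
      · linear_combination e₂₀
      · linear_combination 2 * e₁₁
      · linear_combination e₂₁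
      · linear_combination 2 * e₁₂
      · linear_combination e₂₂
    rw [sum_smul_nine]
    trans (A * (A * B - B * A) - (A * B - B * A) * A + c₁ • 1 + c₂ • A + c₃ • B) +
      (2 * s - x₂) • (B * A - p₁ • 1 - p₂ • A - p₃ • B) +
      (2 * t - x₃) • (B ^ 2 - y₁ • 1 - y₂ • A - y₃ • B) -
      (s' - p₂) • (A ^ 2 - x₁ • 1 - x₂ • A - x₃ • B) -
      (t' - p₃) • (A * B - p₁ • 1 - p₂ • A - p₃ • B)
    · module
    rw [hAC, hBA, hBB, hAA, hAB]
    ext i j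
    fin_cases i <;> fin_cases j <;> simp <;> ring
  · rw [LinearIndependent.pair_iff] at hcd
    push Not at hcd
    obtain ⟨s, t, hst, hne⟩ := hcd
    refine ⟨![-(s * x₁ + t * p₁), -(s * x₂ + t * p₂), s, -(s * x₃ + t * p₃), 0, t, 0, 0, 0],
      ?_, ?_⟩
    · simp at hst
      obtain ⟨e₁, e₂, e₃⟩ := hst
      rw [sum_smul_nine]
      trans s • (A ^ 2 - x₁ • 1 - x₂ • A - x₃ • B) + t • (A * B - p₁ • 1 - p₂ • A - p₃ • B)
      · module
      rw [hAA, hAB]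
      ext i j
      fin_cases i <;> fin_cases j <;> simp [e₁, e₂, e₃]
    · by_cases hs : s = 0
      · exact ⟨5, hne hs⟩
      · exact ⟨2, hs⟩

/-- Linear dependence of the nine matrices is invariant under simultaneous conjugation. -/
lemma not_linearIndependent_nine_of_conj {K : Type*} [Field K]
    {A B A' B' P : Matrix (Fin 3) (Fin 3) K} (hP : IsUnit P) (hA : A * P = P * A')
    (hB : B * P = P * B') (h : ¬ LinearIndependent K (nine A' B')) :
    ¬ LinearIndependent K (nine A B) := by
  have hmul : ∀ {M N M' N' : Matrix (Fin 3) (Fin 3) K}, SemiconjBy P M' M → SemiconjBy P N' N →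
      SemiconjBy P (M' * N' - N' * M') (M * N - N * M) :=
    fun h₁ h₂ => (h₁.mul_right h₂).sub_right (h₂.mul_right h₁)
  have hA' : SemiconjBy P A' A := hA.symm
  have hB' : SemiconjBy P B' B := hB.symm
  have hnine : ∀ i, SemiconjBy P (nine A' B' i) (nine A B i) := by
    intro i
    fin_cases i
    exacts [SemiconjBy.one_right P, hA', hA'.pow_right 2, hB', hB'.pow_right 2, hA'.mul_right hB',
      hB'.mul_right hA', hmul hA' (hmul hA' hB'), hmul hB' (hmul hB' hA')]
  rw [Fintype.not_linearIndependent_iff] at h ⊢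
  obtain ⟨g, hg, hi⟩ := h
  refine ⟨g, hP.mul_left_injective ?_, hi⟩
  have hsum : (∑ i, g i • nine A B i) * P = P * ∑ i, g i • nine A' B' i := by
    simp_rw [Finset.sum_mul, Finset.mul_sum, smul_mul_assoc, mul_smul_comm, (hnine _).eq]
  simpa [hg] using hsum

/-- The nine matrices are dependent if `A` and `B` have a common eigenvector. -/
lemma not_linearIndependent_nine_of_common_eigenvector {K : Type*} [Field K]
    {A B : Matrix (Fin 3) (Fin 3) K} {v : Fin 3 → K} (hv : v ≠ 0) {a b : K}
    (hA : A *ᵥ v = a • v) (hB : B *ᵥ v = b • v) : ¬ LinearIndependent K (nine A B) := by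
  intro h
  let S : Subalgebra K (Matrix (Fin 3) (Fin 3) K) :=
    { carrier := {M | ∃ k : K, M *ᵥ v = k • v}
      mul_mem' := by
        rintro M N ⟨m, hm⟩ ⟨n, hn⟩
        exact ⟨n * m, by rw [← mulVec_mulVec, hn, mulVec_smul, hm, smul_smul]⟩
      add_mem' := by
        rintro M N ⟨m, hm⟩ ⟨n, hn⟩
        exact ⟨m + n, by rw [add_mulVec, hm, hn, add_smul]⟩
      algebraMap_mem' := fun r => ⟨r, by
        rw [Algebra.algebraMap_eq_smul_one, smul_mulVec, one_mulVec]⟩ }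
  have hAS : A ∈ S := ⟨a, hA⟩
  have hBS : B ∈ S := ⟨b, hB⟩
  have hcomm : ∀ {M N}, M ∈ S → N ∈ S → M * N - N * M ∈ S :=
    fun hM hN => sub_mem (mul_mem hM hN) (mul_mem hN hM)
  have hspan := h.span_eq_top_of_card_eq_finrank' (by simp [Module.finrank_matrix])
  have hle : Submodule.span K (Set.range (nine A B)) ≤ Subalgebra.toSubmodule S := by
    rw [Submodule.span_le]
    rintro _ ⟨i, rfl⟩
    fin_cases i
    exacts [S.one_mem, hAS, S.pow_mem hAS 2, hBS, S.pow_mem hBS 2, S.mul_mem hAS hBS,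
      S.mul_mem hBS hAS, hcomm hAS (hcomm hAS hBS), hcomm hBS (hcomm hBS hAS)]
  rw [hspan] at hle
  obtain ⟨i, hi⟩ := Function.ne_iff.mp hv
  obtain ⟨j, hj⟩ := exists_ne i
  obtain ⟨k, hk⟩ : ∃ k : K, Matrix.single j i 1 *ᵥ v = k • v := hle Submodule.mem_top
  rw [Matrix.single_mulVec] at hk
  have hki := congrFun hk i
  have hkj := congrFun hk j
  simp only [Function.update_apply, hj.symm, if_true, if_false, Pi.zero_apply, Pi.smul_apply,
    smul_eq_mul, one_mul] at hki hkj
  have hk0 : k = 0 := (mul_eq_zero.mp hki.symm).resolve_right hi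
  exact hi (by rw [hkj, hk0, zero_mul]; rfl)

/-- The nine matrices are dependent if a nonscalar element of the pencil spanned by `A`, `B` and
the identity has square proportional to itself. -/
lemma not_linearIndependent_nine_of_mul_self {K : Type*} [Field K]
    {A B : Matrix (Fin 3) (Fin 3) K} {a b c t : K} (hbc : b ≠ 0 ∨ c ≠ 0)
    (h : (a • (1 : Matrix (Fin 3) (Fin 3) K) + b • A + c • B) * (a • 1 + b • A + c • B) =
      t • (a • 1 + b • A + c • B)) : ¬ LinearIndependent K (nine A B) := by
  rw [Fintype.not_linearIndependent_iff]
  refine ⟨![a ^ 2 - t * a, 2 * a * b - t * b, b ^ 2, 2 * a * c - t * c, c ^ 2, b * c, b * c, 0, 0],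
    ?_, ?_⟩
  · rw [sum_smul_nine, ← sub_eq_zero.mpr h, pow_two A, pow_two B]
    simp only [add_mul, mul_add, smul_mul_assoc, mul_smul_comm, one_mul, mul_one]
    module
  · rcases hbc with hb | hc
    · exact ⟨2, pow_ne_zero 2 hb⟩
    · exact ⟨4, pow_ne_zero 2 hc⟩

lemma exists_smul_of_not_linearIndependent {K V : Type*} [Field K] [AddCommGroup V] [Module K V]
    {v u : V} (hv : v ≠ 0) (h : ¬ LinearIndependent K ![v, u]) : ∃ k : K, u = k • v := by
  rw [LinearIndependent.pair_iff' hv] at h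
  push Not at h
  exact h.imp fun _ => Eq.symm

/-- The nine matrices are dependent if `AB` and `BA` agree on a vector `v` which is not cyclic. -/
lemma not_linearIndependent_nine_of_dependent {K : Type*} [Field K]
    {A B : Matrix (Fin 3) (Fin 3) K} {v : Fin 3 → K} (hv : v ≠ 0)
    (hcomm : A *ᵥ (B *ᵥ v) = B *ᵥ (A *ᵥ v)) {a b c : K} (hbc : b ≠ 0 ∨ c ≠ 0)
    (h : a • v + b • A *ᵥ v + c • B *ᵥ v = 0) : ¬ LinearIndependent K (nine A B) := by
  set N := a • (1 : Matrix (Fin 3) (Fin 3) K) + b • A + c • B with hN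
  have hNv : ∀ u, N *ᵥ u = a • u + b • A *ᵥ u + c • B *ᵥ u := by
    intro u
    simp [hN, add_mulVec, smul_mulVec]
  have hNA : N *ᵥ (A *ᵥ v) = 0 := by
    have := congrArg (A *ᵥ ·) h
    simpa [hNv, mulVec_add, mulVec_smul, hcomm] using this
  have hNB : N *ᵥ (B *ᵥ v) = 0 := by
    have := congrArg (B *ᵥ ·) h
    simpa [hNv, mulVec_add, mulVec_smul, hcomm] using this
  have hN0 : N *ᵥ v = 0 := by rw [hNv, h]
  by_cases hA : LinearIndependent K ![v, A *ᵥ v]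
  · obtain ⟨t, ht⟩ := exists_mul_self_eq_smul hN0 hNA hA
    exact not_linearIndependent_nine_of_mul_self hbc ht
  by_cases hB : LinearIndependent K ![v, B *ᵥ v]
  · obtain ⟨t, ht⟩ := exists_mul_self_eq_smul hN0 hNB hB
    exact not_linearIndependent_nine_of_mul_self hbc ht
  obtain ⟨k, hk⟩ := exists_smul_of_not_linearIndependent hv hA
  obtain ⟨l, hl⟩ := exists_smul_of_not_linearIndependent hv hB
  exact not_linearIndependent_nine_of_common_eigenvector hv hk hl

/-- The nine matrices are dependent if `AB` and `BA` agree on a vector `v` such that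
`v, Av, Bv` is a basis. -/
lemma not_linearIndependent_nine_of_cyclic {K : Type*} [Field K]
    {A B : Matrix (Fin 3) (Fin 3) K} {v : Fin 3 → K}
    (hcomm : A *ᵥ (B *ᵥ v) = B *ᵥ (A *ᵥ v)) (hind : LinearIndependent K ![v, A *ᵥ v, B *ᵥ v]) :
    ¬ LinearIndependent K (nine A B) := by
  set P : Matrix (Fin 3) (Fin 3) K := Matrix.of ![v, A *ᵥ v, B *ᵥ v] with hP
  have hPu : IsUnit Pᵀ := (isUnit_transpose P).mpr (linearIndependent_rows_iff_isUnit.mp hind)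
  have hcol : ∀ u, ∃ q₁ q₂ q₃ : K, u = q₁ • v + q₂ • A *ᵥ v + q₃ • B *ᵥ v := by
    intro u
    obtain ⟨q, hq⟩ := (Matrix.mulVec_surjective_iff_isUnit.mpr hPu) u
    refine ⟨q 0, q 1, q 2, ?_⟩
    rw [← hq, mulVec_transpose, vecMul_eq_sum, Fin.sum_univ_three]
    rfl
  obtain ⟨x₁, x₂, x₃, hx⟩ := hcol (A *ᵥ (A *ᵥ v))
  obtain ⟨y₁, y₂, y₃, hy⟩ := hcol (B *ᵥ (B *ᵥ v))
  obtain ⟨p₁, p₂, p₃, hp⟩ := hcol (A *ᵥ (B *ᵥ v))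
  have hp' := hcomm.symm.trans hp
  have key : ∀ {M M' : Matrix (Fin 3) (Fin 3) K},
      (∀ j, M *ᵥ P j = M' 0 j • v + M' 1 j • A *ᵥ v + M' 2 j • B *ᵥ v) → M * Pᵀ = Pᵀ * M' := by
    intro M M' h
    ext i j
    have := congrFun (h j) i
    simp only [Matrix.mul_apply, transpose_apply, Fin.sum_univ_three]
    simp only [Pi.add_apply, Pi.smul_apply, smul_eq_mul] at this
    simp only [Matrix.mulVec, dotProduct, Fin.sum_univ_three] at this
    simp [hP, Matrix.mulVec, dotProduct, Fin.sum_univ_three] at this ⊢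
    linear_combination this
  refine not_linearIndependent_nine_of_conj hPu (key ?_) (key ?_)
    (not_linearIndependent_nine_normalForm x₁ x₂ x₃ y₁ y₂ y₃ p₁ p₂ p₃)
  · intro j
    fin_cases j
    · change A *ᵥ v = (0 : K) • v + (1 : K) • A *ᵥ v + (0 : K) • B *ᵥ v
      simp
    · exact hx
    · exact hp
  · intro j
    fin_cases j
    · change B *ᵥ v = (0 : K) • v + (0 : K) • A *ᵥ v + (1 : K) • B *ᵥ v
      simp
    · exact hp'
    · exact hy

lemma not_linearIndependent_nine {K : Type*} [Field K] {A B : Matrix (Fin 3) (Fin 3) K}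
    (hdet : (A * B - B * A).det = 0) : ¬ LinearIndependent K (nine A B) := by
  obtain ⟨v, hv, hCv⟩ := Matrix.exists_mulVec_eq_zero_iff.mpr hdet
  have hcomm : A *ᵥ (B *ᵥ v) = B *ᵥ (A *ᵥ v) := by
    rwa [sub_mulVec, sub_eq_zero, ← mulVec_mulVec, ← mulVec_mulVec] at hCv
  by_cases hind : LinearIndependent K ![v, A *ᵥ v, B *ᵥ v]
  · exact not_linearIndependent_nine_of_cyclic hcomm hind
  rw [Fintype.not_linearIndependent_iff] at hind
  obtain ⟨g, hg, i, hi⟩ := hind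
  rw [Fin.sum_univ_three] at hg
  refine not_linearIndependent_nine_of_dependent hv hcomm ?_ hg
  by_contra! hbc
  simp [hbc, hv] at hg
  fin_cases i
  exacts [hi hg, hi hbc.1, hi hbc.2]

lemma vecDet_eq_zero_of_not_linearIndependent {K : Type*} [Field K]
    {v : Fin 9 → Matrix (Fin 3) (Fin 3) K} (h : ¬ LinearIndependent K v) : vecDet v = 0 := by
  rw [Fintype.not_linearIndependent_iff] at h
  obtain ⟨g, hg, i, hi⟩ := h
  refine Matrix.exists_mulVec_eq_zero_iff.mp ⟨fun q => g (finProdFinEquiv q), ?_, ?_⟩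
  · intro h0
    have := congrFun h0 (finProdFinEquiv.symm i)
    simp only [Equiv.apply_symm_apply] at this
    exact hi this
  · ext p
    have := congrFun (congrFun hg p.1) p.2
    rw [← (finProdFinEquiv (m := 3) (n := 3)).sum_comp (fun i : Fin 9 => g i • v i)] at this
    simpa [Matrix.mulVec, dotProduct, Matrix.sum_apply, mul_comm] using this

theorem stmt_13 {K : Type*} [Field K] (A B : Matrix (Fin 3) (Fin 3) K)
    (hdet : (A * B - B * A).det = 0) :
    vecDet (nine A B) = 0 ∧
    -9 * ((A * B - B * A).det) ^ 2 * Hm (A * B - B * A) = 0 ∧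
    ¬ LinearIndependent K (nine A B) := by
  have hlin := not_linearIndependent_nine hdet
  exact ⟨vecDet_eq_zero_of_not_linearIndependent hlin, by simp [hdet], hlin⟩
end
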